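/- arXiv:2505.20337 — 3 statements merged into one kernel-verified Lean document; each statement's English description precedes it below -/
import Mathlib

section
/- Let N, L, P ≥ 1, let U_{p,l} (p ∈ [P], l ∈ [L]) be arbitrary 2^N × 2^N unitaries, and for data x = (x_{l,n,i}) ∈ ℝ^{3NL} define the P-repeated data re-uploading circuit V(x) = ∏_{p=P}^{1} ∏_{l=L}^{1} U_{p,l} R_l(x_{[l]}) and output h_P(x) = Tr[H V(x) ρ₀ V(x)†], where ρ₀ = (|0⟩⟨0|)^{⊗N} and H is a 2^N × 2^N Hermitian matrix with all eigenvalues in [−1,1]. Then for any two data vectors x, x̃ ∈ ℝ^{3NL}: |h_P(x) − h_P(x̃)| ≤ P · Σ_{l=1}^{L} Σ_{n=1}^{N} Σ_{i=1}^{3} |x_{l,n,i} − x̃_{l,n,i}|. In particular, if every coordinate satisfies |x_{l,n,i} − x̃_{l,n,i}| ≤ 2^{−q} and q ≥ ⌈log₂(3PLN/δ)⌉ for some δ > 0, then |h_P(x) − h_P(x̃)| ≤ δ. -/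
open Matrix MeasureTheory ProbabilityTheory
open scoped NNReal ENNReal ComplexOrder

noncomputable section

/-- Pauli X matrix. -/
def PX : Matrix (Fin 2) (Fin 2) ℂ := !![0, 1; 1, 0]

/-- Pauli Y matrix. -/
def PY : Matrix (Fin 2) (Fin 2) ℂ := !![0, -Complex.I; Complex.I, 0]

/-- Pauli Z matrix. -/
def PZ : Matrix (Fin 2) (Fin 2) ℂ := !![1, 0; 0, -1]

/-- Rotation gate `exp(-i·x·P/2) = cos(x/2)·I - i·sin(x/2)·P` for a Pauli matrix `P`. -/
def rotG (P : Matrix (Fin 2) (Fin 2) ℂ) (x : ℝ) : Matrix (Fin 2) (Fin 2) ℂ :=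
  (Real.cos (x / 2) : ℂ) • (1 : Matrix (Fin 2) (Fin 2) ℂ)
    - (Complex.I * (Real.sin (x / 2) : ℂ)) • P

/-- `R_z` rotation gate. -/
def Rz (x : ℝ) : Matrix (Fin 2) (Fin 2) ℂ := rotG PZ x

/-- `R_y` rotation gate. -/
def Ry (x : ℝ) : Matrix (Fin 2) (Fin 2) ℂ := rotG PY x

/-- Single-qubit encoding gate `R(v) = R_z(v₃) R_y(v₂) R_z(v₁)`. -/
def encGate (v : Fin 3 → ℝ) : Matrix (Fin 2) (Fin 2) ℂ :=
  Rz (v 2) * Ry (v 1) * Rz (v 0)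

/-- Kronecker product of a family of `2 × 2` matrices, indexed by `Fin N → Fin 2`. -/
def kron {N : ℕ} (A : Fin N → Matrix (Fin 2) (Fin 2) ℂ) :
    Matrix (Fin N → Fin 2) (Fin N → Fin 2) ℂ :=
  Matrix.of fun i j => ∏ n, A n (i n) (j n)

/-- Encoding-layer gate `R_l(x_{[l]}) = ⊗ₙ R(x_{l,n})`. -/
def layerGate {N : ℕ} (x : Fin N → Fin 3 → ℝ) :
    Matrix (Fin N → Fin 2) (Fin N → Fin 2) ℂ :=
  kron fun n => encGate (x n)

/-- `|0⟩⟨0|`. -/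
def ket0 : Matrix (Fin 2) (Fin 2) ℂ := !![1, 0; 0, 0]

/-- The initial state `ρ₀ = (|0⟩⟨0|)^{⊗N}`. -/
def rho0 (N : ℕ) : Matrix (Fin N → Fin 2) (Fin N → Fin 2) ℂ := kron fun _ => ket0

section NormBounds

open scoped Matrix.Norms.L2Operator

section NormedRing

variable {A : Type*} [NormedRing A] [NormOneClass A]

lemma norm_reverse_prod_ofFn_le_one {n : ℕ} (f : Fin n → A) (hf : ∀ i, ‖f i‖ ≤ 1) :
    ‖(List.ofFn f).reverse.prod‖ ≤ 1 := by
  induction n with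
  | zero => simp
  | succ n ih =>
    rw [List.ofFn_succ, List.reverse_cons, List.prod_append, List.prod_singleton]
    exact (norm_mul_le _ _).trans
      (mul_le_one₀ (ih _ fun i => hf i.succ) (norm_nonneg _) (hf 0))

/-- Products of contractions depend on their factors with total error at most the sum of the
errors of the factors. -/
lemma norm_reverse_prod_ofFn_sub_le {n : ℕ} (f g : Fin n → A) (hf : ∀ i, ‖f i‖ ≤ 1)
    (hg : ∀ i, ‖g i‖ ≤ 1) :
    ‖(List.ofFn f).reverse.prod - (List.ofFn g).reverse.prod‖ ≤ ∑ i, ‖f i - g i‖ := by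
  induction n with
  | zero => simp
  | succ n ih =>
    simp only [List.ofFn_succ, List.reverse_cons, List.prod_append, List.prod_singleton,
      Fin.sum_univ_succ]
    set F := (List.ofFn fun i : Fin n => f i.succ).reverse.prod
    set G := (List.ofFn fun i : Fin n => g i.succ).reverse.prod
    have hF : ‖F‖ ≤ 1 := norm_reverse_prod_ofFn_le_one _ fun i => hf i.succ
    have hFG : ‖F - G‖ ≤ ∑ i : Fin n, ‖f i.succ - g i.succ‖ :=
      ih _ _ (fun i => hf i.succ) (fun i => hg i.succ)
    calc ‖F * f 0 - G * g 0‖ = ‖F * (f 0 - g 0) + (F - G) * g 0‖ := by congr 1; noncomm_ring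
      _ ≤ ‖F‖ * ‖f 0 - g 0‖ + ‖F - G‖ * ‖g 0‖ :=
        (norm_add_le _ _).trans (add_le_add (norm_mul_le _ _) (norm_mul_le _ _))
      _ ≤ ‖f 0 - g 0‖ + ‖F - G‖ :=
        add_le_add (mul_le_of_le_one_left (norm_nonneg _) hF)
          (mul_le_of_le_one_right (norm_nonneg _) (hg 0))
      _ ≤ _ := by gcongr

end NormedRing

section MatrixNorm

variable {n : Type*} [Fintype n] [DecidableEq n]

lemma l2_opNorm_le_one_of_mem_unitaryGroup {U : Matrix n n ℂ} (hU : U ∈ unitaryGroup n ℂ) :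
    ‖U‖ ≤ 1 := by
  cases subsingleton_or_nontrivial (Matrix n n ℂ)
  · simp [Subsingleton.elim U 0]
  · exact (CStarRing.norm_of_mem_unitary hU).le

lemma norm_entry_le_l2_opNorm (A : Matrix n n ℂ) (i j : n) : ‖A i j‖ ≤ ‖A‖ := by
  have h := l2_opNorm_mulVec A (EuclideanSpace.single j (1 : ℂ))
  refine le_trans ?_ (h.trans (by simp))
  refine le_trans (le_of_eq ?_) (PiLp.norm_apply_le _ i)
  simp

lemma Matrix.IsHermitian.l2_opNorm_le_one {H : Matrix n n ℂ} (hH : H.IsHermitian)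
    (hEig : ∀ i, hH.eigenvalues i ∈ Set.Icc (-1 : ℝ) 1) : ‖H‖ ≤ 1 := by
  rw [hH.spectral_theorem]
  refine (NonUnitalStarAlgHom.norm_apply_le _ _).trans ?_
  rw [l2_opNorm_diagonal, pi_norm_le_iff_of_nonneg zero_le_one]
  intro i
  simpa [abs_le] using hEig i

end MatrixNorm

lemma star_rotG_mul_rotG {P : Matrix (Fin 2) (Fin 2) ℂ} (hP : Pᴴ = P) (hP2 : P * P = 1)
    (c s : ℝ) :
    star ((c : ℂ) • (1 : Matrix (Fin 2) (Fin 2) ℂ) - (Complex.I * (s : ℂ)) • P) *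
      ((c : ℂ) • (1 : Matrix (Fin 2) (Fin 2) ℂ) - (Complex.I * (s : ℂ)) • P) =
      ((c ^ 2 + s ^ 2 : ℝ) : ℂ) • 1 := by
  have h : star ((c : ℂ) • (1 : Matrix (Fin 2) (Fin 2) ℂ) - (Complex.I * (s : ℂ)) • P) =
      (c : ℂ) • (1 : Matrix (Fin 2) (Fin 2) ℂ) + (Complex.I * (s : ℂ)) • P := by
    simp [star_eq_conjTranspose, hP, sub_eq_add_neg]
  rw [h]
  simp only [add_mul, mul_sub, smul_mul_smul_comm, hP2, one_mul, mul_one]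
  have hI : Complex.I * (s : ℂ) * (Complex.I * s) = -(s : ℂ) ^ 2 := by
    linear_combination (s : ℂ) ^ 2 * Complex.I_mul_I
  rw [hI]
  push_cast
  module

lemma rotG_mem_unitaryGroup {P : Matrix (Fin 2) (Fin 2) ℂ} (hP : Pᴴ = P) (hP2 : P * P = 1)
    (x : ℝ) : rotG P x ∈ unitaryGroup (Fin 2) ℂ := by
  rw [mem_unitaryGroup_iff', rotG, star_rotG_mul_rotG hP hP2]
  simp

lemma norm_rotG_sub_le {P : Matrix (Fin 2) (Fin 2) ℂ} (hP : Pᴴ = P) (hP2 : P * P = 1)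
    (x y : ℝ) : ‖rotG P x - rotG P y‖ ≤ |x - y| / 2 := by
  have hD : rotG P x - rotG P y =
      ((Real.cos (x / 2) - Real.cos (y / 2) : ℝ) : ℂ) • (1 : Matrix (Fin 2) (Fin 2) ℂ) -
        (Complex.I * ((Real.sin (x / 2) - Real.sin (y / 2) : ℝ) : ℂ)) • P := by
    simp only [rotG, Complex.ofReal_sub, mul_sub, sub_smul]
    abel
  have hsq : ‖rotG P x - rotG P y‖ * ‖rotG P x - rotG P y‖ =
      (Real.cos (x / 2) - Real.cos (y / 2)) ^ 2 + (Real.sin (x / 2) - Real.sin (y / 2)) ^ 2 := by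
    rw [← CStarRing.norm_star_mul_self, hD, star_rotG_mul_rotG hP hP2, norm_smul, norm_one,
      mul_one, Complex.norm_real, Real.norm_of_nonneg (by positivity)]
  have hcos := Real.one_sub_sq_div_two_le_cos (x := x / 2 - y / 2)
  rw [Real.cos_sub] at hcos
  refine abs_le_of_sq_le_sq' ?_ (by positivity) |>.2
  rw [div_pow, sq_abs]
  nlinarith [Real.sin_sq_add_cos_sq (x / 2), Real.sin_sq_add_cos_sq (y / 2)]

lemma PZ_conjTranspose : PZᴴ = PZ := by
  ext i j; fin_cases i <;> fin_cases j <;> simp [PZ]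

lemma PZ_mul_self : PZ * PZ = 1 := by
  ext i j; fin_cases i <;> fin_cases j <;> simp [PZ]

lemma PY_conjTranspose : PYᴴ = PY := by
  ext i j; fin_cases i <;> fin_cases j <;> simp [PY]

lemma PY_mul_self : PY * PY = 1 := by
  ext i j; fin_cases i <;> fin_cases j <;> simp [PY]

lemma Rz_mem_unitaryGroup (x : ℝ) : Rz x ∈ unitaryGroup (Fin 2) ℂ :=
  rotG_mem_unitaryGroup PZ_conjTranspose PZ_mul_self x

lemma Ry_mem_unitaryGroup (x : ℝ) : Ry x ∈ unitaryGroup (Fin 2) ℂ :=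
  rotG_mem_unitaryGroup PY_conjTranspose PY_mul_self x

lemma encGate_mem_unitaryGroup (v : Fin 3 → ℝ) : encGate v ∈ unitaryGroup (Fin 2) ℂ :=
  mul_mem (mul_mem (Rz_mem_unitaryGroup _) (Ry_mem_unitaryGroup _)) (Rz_mem_unitaryGroup _)

lemma encGate_eq_reverse_prod (v : Fin 3 → ℝ) :
    encGate v = (List.ofFn ![Rz (v 0), Ry (v 1), Rz (v 2)]).reverse.prod := by
  simp [encGate, mul_assoc]

lemma norm_encGate_sub_le (v w : Fin 3 → ℝ) :
    ‖encGate v - encGate w‖ ≤ (∑ i, |v i - w i|) / 2 := by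
  rw [encGate_eq_reverse_prod, encGate_eq_reverse_prod, Finset.sum_div]
  have hnorm (u : Fin 3 → ℝ) (i : Fin 3) : ‖![Rz (u 0), Ry (u 1), Rz (u 2)] i‖ ≤ 1 := by
    apply l2_opNorm_le_one_of_mem_unitaryGroup
    fin_cases i
    exacts [Rz_mem_unitaryGroup _, Ry_mem_unitaryGroup _, Rz_mem_unitaryGroup _]
  refine (norm_reverse_prod_ofFn_sub_le _ _ (hnorm v) (hnorm w)).trans
    (Finset.sum_le_sum fun i _ => ?_)
  fin_cases i
  exacts [norm_rotG_sub_le PZ_conjTranspose PZ_mul_self _ _,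
    norm_rotG_sub_le PY_conjTranspose PY_mul_self _ _,
    norm_rotG_sub_le PZ_conjTranspose PZ_mul_self _ _]

section Kron

variable {N : ℕ}

lemma kron_mul (A B : Fin N → Matrix (Fin 2) (Fin 2) ℂ) :
    kron A * kron B = kron fun n => A n * B n := by
  ext i j
  simp only [kron, mul_apply, of_apply, ← Finset.prod_mul_distrib]
  exact (Fintype.prod_sum fun n k => A n (i n) k * B n k (j n)).symm

lemma kron_conjTranspose (A : Fin N → Matrix (Fin 2) (Fin 2) ℂ) :
    (kron A)ᴴ = kron fun n => (A n)ᴴ := by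
  ext i j
  simp [kron]

lemma kron_one : kron (fun _ : Fin N => (1 : Matrix (Fin 2) (Fin 2) ℂ)) = 1 := by
  ext i j
  simp only [kron, of_apply, one_apply, Fintype.prod_boole, funext_iff]
  congr

lemma kron_mem_unitaryGroup {A : Fin N → Matrix (Fin 2) (Fin 2) ℂ}
    (hA : ∀ n, A n ∈ unitaryGroup (Fin 2) ℂ) : kron A ∈ unitaryGroup (Fin N → Fin 2) ℂ := by
  rw [mem_unitaryGroup_iff', star_eq_conjTranspose, kron_conjTranspose, kron_mul, ← kron_one]
  congr 1
  funext n
  exact mem_unitaryGroup_iff'.1 (hA n)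

lemma kron_update_apply (A : Fin N → Matrix (Fin 2) (Fin 2) ℂ) (a : Fin N)
    (M : Matrix (Fin 2) (Fin 2) ℂ) (i j : Fin N → Fin 2) :
    kron (Function.update A a M) i j =
      M (i a) (j a) * ∏ n ∈ Finset.univ.erase a, A n (i n) (j n) := by
  simp only [kron, of_apply]
  rw [← Finset.mul_prod_erase _ _ (Finset.mem_univ a), Function.update_self]
  congr 1
  exact Finset.prod_congr rfl fun n hn => by rw [Function.update_of_ne (Finset.ne_of_mem_erase hn)]

/-- The operator acting as a given `2 × 2` matrix on one qubit and trivially on the others. -/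
def singleQubit (a : Fin N) :
    Matrix (Fin 2) (Fin 2) ℂ →⋆ₙₐ[ℂ] Matrix (Fin N → Fin 2) (Fin N → Fin 2) ℂ where
  toFun M := kron (Function.update (fun _ => 1) a M)
  map_smul' c M := by
    ext i j
    simp [kron_update_apply, mul_assoc]
  map_zero' := by
    ext i j
    simp [kron_update_apply]
  map_add' M M' := by
    ext i j
    simp [kron_update_apply, add_mul]
  map_mul' M M' := by
    rw [kron_mul]
    congr 1
    funext n
    by_cases h : n = a
    · subst h; simp
    · simp [h]
  map_star' M := by
    rw [star_eq_conjTranspose, star_eq_conjTranspose, kron_conjTranspose]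
    congr 1
    funext n
    by_cases h : n = a
    · subst h; simp
    · simp [h]

lemma kron_update_eq (A : Fin N → Matrix (Fin 2) (Fin 2) ℂ) (a : Fin N)
    (M : Matrix (Fin 2) (Fin 2) ℂ) :
    kron (Function.update A a M) = singleQubit a M * kron (Function.update A a 1) := by
  change _ = kron _ * kron _
  rw [kron_mul]
  congr 1
  funext n
  by_cases h : n = a
  · subst h; simp
  · simp [h]

lemma norm_kron_update_sub_le {A : Fin N → Matrix (Fin 2) (Fin 2) ℂ}
    (hA : ∀ n, A n ∈ unitaryGroup (Fin 2) ℂ) (a : Fin N) (M M' : Matrix (Fin 2) (Fin 2) ℂ) :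
    ‖kron (Function.update A a M) - kron (Function.update A a M')‖ ≤ ‖M - M'‖ := by
  rw [kron_update_eq, kron_update_eq A a M', ← sub_mul, ← map_sub]
  have hu : kron (Function.update A a 1) ∈ unitaryGroup (Fin N → Fin 2) ℂ := by
    refine kron_mem_unitaryGroup fun n => ?_
    by_cases h : n = a
    · subst h; simp [one_mem]
    · simpa [h] using hA n
  exact (norm_mul_le _ _).trans ((mul_le_of_le_one_right (norm_nonneg _)
    (l2_opNorm_le_one_of_mem_unitaryGroup hu)).trans (NonUnitalStarAlgHom.norm_apply_le _ _))

lemma norm_kron_sub_le {A B : Fin N → Matrix (Fin 2) (Fin 2) ℂ}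
    (hA : ∀ n, A n ∈ unitaryGroup (Fin 2) ℂ) (hB : ∀ n, B n ∈ unitaryGroup (Fin 2) ℂ) :
    ‖kron A - kron B‖ ≤ ∑ n, ‖A n - B n‖ := by
  have key (s : Finset (Fin N)) :
      ‖kron (s.piecewise A B) - kron B‖ ≤ ∑ n ∈ s, ‖A n - B n‖ := by
    induction s using Finset.induction_on with
    | empty => simp
    | insert a s ha ih =>
      have hs (n : Fin N) : s.piecewise A B n ∈ unitaryGroup (Fin 2) ℂ := by
        by_cases h : n ∈ s <;> simp [h, hA, hB]
      have hstep := norm_kron_update_sub_le hs a (A a) (B a)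
      rw [← Finset.piecewise_insert, ← Finset.piecewise_eq_of_notMem s A B ha,
        Function.update_eq_self] at hstep
      rw [Finset.piecewise_eq_of_notMem s A B ha] at hstep
      rw [Finset.sum_insert ha]
      exact (norm_sub_le_norm_sub_add_norm_sub _ _ _).trans (add_le_add hstep ih)
  simpa using key Finset.univ

lemma layerGate_mem_unitaryGroup (x : Fin N → Fin 3 → ℝ) :
    layerGate x ∈ unitaryGroup (Fin N → Fin 2) ℂ :=
  kron_mem_unitaryGroup fun n => encGate_mem_unitaryGroup (x n)

lemma norm_layerGate_sub_le (x y : Fin N → Fin 3 → ℝ) :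
    ‖layerGate x - layerGate y‖ ≤ (∑ n, ∑ i, |x n i - y n i|) / 2 := by
  rw [Finset.sum_div]
  exact (norm_kron_sub_le (fun n => encGate_mem_unitaryGroup (x n))
    fun n => encGate_mem_unitaryGroup (y n)).trans
      (Finset.sum_le_sum fun n _ => norm_encGate_sub_le _ _)

lemma rho0_eq_single : rho0 N = Matrix.single (fun _ => 0) (fun _ => 0) 1 := by
  ext i j
  have hket (a b : Fin 2) : ket0 a b = if 0 = a ∧ 0 = b then 1 else 0 := by
    fin_cases a <;> fin_cases b <;> simp [ket0]
  simp only [rho0, kron, of_apply, hket, Fintype.prod_boole, single_apply, funext_iff, forall_and]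

lemma trace_mul_conj_rho0 (H V : Matrix (Fin N → Fin 2) (Fin N → Fin 2) ℂ) :
    (H * (V * rho0 N * Vᴴ)).trace = (Vᴴ * H * V) (fun _ => 0) (fun _ => 0) := by
  rw [rho0_eq_single, ← Matrix.mul_assoc, ← Matrix.mul_assoc, Matrix.trace_mul_comm,
    ← Matrix.mul_assoc, ← Matrix.mul_assoc, Matrix.trace_mul_single]
  simp

end Kron

/-- Expectation values of a contractive observable are `2`-Lipschitz in the circuit operator. -/
lemma abs_re_trace_sub_le {N : ℕ} {H V W : Matrix (Fin N → Fin 2) (Fin N → Fin 2) ℂ}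
    (hH : ‖H‖ ≤ 1) (hV : ‖V‖ ≤ 1) (hW : ‖W‖ ≤ 1) :
    |(H * (V * rho0 N * Vᴴ)).trace.re - (H * (W * rho0 N * Wᴴ)).trace.re| ≤ 2 * ‖V - W‖ := by
  rw [trace_mul_conj_rho0, trace_mul_conj_rho0, ← Complex.sub_re, ← Matrix.sub_apply]
  refine (Complex.abs_re_le_norm _).trans ((norm_entry_le_l2_opNorm _ _ _).trans ?_)
  have hsplit : Vᴴ * H * V - Wᴴ * H * W = Vᴴ * H * (V - W) + (V - W)ᴴ * H * W := by
    rw [conjTranspose_sub]; noncomm_ring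
  rw [hsplit, two_mul]
  refine (norm_add_le _ _).trans (add_le_add ?_ ?_)
  · refine (norm_mul_le _ _).trans (mul_le_of_le_one_left (norm_nonneg _) ?_)
    exact (norm_mul_le _ _).trans
      (mul_le_one₀ (by rwa [l2_opNorm_conjTranspose]) (norm_nonneg _) hH)
  · refine (norm_mul_le _ _).trans ((mul_le_of_le_one_right (norm_nonneg _) hW).trans ?_)
    refine (norm_mul_le _ _).trans ((mul_le_of_le_one_right (norm_nonneg _) hH).trans ?_)
    rw [l2_opNorm_conjTranspose]

/-- The circuit output is Lipschitz in the data, every layer being uploaded `P` times. -/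
lemma abs_circuit_output_sub_le {N L P : ℕ}
    {U : Fin P → Fin L → Matrix (Fin N → Fin 2) (Fin N → Fin 2) ℂ}
    (hU : ∀ p l, U p l ∈ unitaryGroup (Fin N → Fin 2) ℂ)
    {H : Matrix (Fin N → Fin 2) (Fin N → Fin 2) ℂ}
    (hH : H.IsHermitian) (hEig : ∀ i, hH.eigenvalues i ∈ Set.Icc (-1 : ℝ) 1)
    {V : (Fin L → Fin N → Fin 3 → ℝ) → Matrix (Fin N → Fin 2) (Fin N → Fin 2) ℂ}
    (hV : ∀ x, V x =
      (List.ofFn fun p : Fin P =>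
        (List.ofFn fun l : Fin L => U p l * layerGate (x l)).reverse.prod).reverse.prod)
    (x y : Fin L → Fin N → Fin 3 → ℝ) :
    |(H * (V x * rho0 N * (V x)ᴴ)).trace.re - (H * (V y * rho0 N * (V y)ᴴ)).trace.re| ≤
      (P : ℝ) * ∑ l, ∑ n, ∑ i, |x l n i - y l n i| := by
  have hgate (z : Fin L → Fin N → Fin 3 → ℝ) (p : Fin P) (l : Fin L) :
      ‖U p l * layerGate (z l)‖ ≤ 1 :=
    l2_opNorm_le_one_of_mem_unitaryGroup (mul_mem (hU p l) (layerGate_mem_unitaryGroup _))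
  have hblock (z : Fin L → Fin N → Fin 3 → ℝ) (p : Fin P) :
      ‖(List.ofFn fun l : Fin L => U p l * layerGate (z l)).reverse.prod‖ ≤ 1 :=
    norm_reverse_prod_ofFn_le_one _ (hgate z p)
  have hcircuit (z : Fin L → Fin N → Fin 3 → ℝ) : ‖V z‖ ≤ 1 := by
    rw [hV]
    exact norm_reverse_prod_ofFn_le_one _ (hblock z)
  have hdiff : ‖V x - V y‖ ≤
      ∑ _p : Fin P, ∑ l, (∑ n, ∑ i, |x l n i - y l n i|) / 2 := by
    rw [hV, hV]
    refine (norm_reverse_prod_ofFn_sub_le _ _ (hblock x) (hblock y)).trans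
      (Finset.sum_le_sum fun p _ => ?_)
    refine (norm_reverse_prod_ofFn_sub_le _ _ (hgate x p) (hgate y p)).trans
      (Finset.sum_le_sum fun l _ => ?_)
    rw [← mul_sub]
    exact (norm_mul_le _ _).trans ((mul_le_of_le_one_left (norm_nonneg _)
      (l2_opNorm_le_one_of_mem_unitaryGroup (hU p l))).trans (norm_layerGate_sub_le _ _))
  refine (abs_re_trace_sub_le (hH.l2_opNorm_le_one hEig) (hcircuit x) (hcircuit y)).trans ?_
  rw [Finset.sum_const, Finset.card_univ, Fintype.card_fin, nsmul_eq_mul,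
    ← Finset.sum_div] at hdiff
  linarith

end NormBounds

/-- The output `h_P(x) = Tr[H V(x) ρ₀ V(x)†]` of a `P`-repeated
`N`-qubit data re-uploading circuit with `L` encoding layers, with observable `H` whose
eigenvalues lie in `[−1,1]`, is Lipschitz in the data:
`|h_P(x) − h_P(x̃)| ≤ P · Σ_{l,n,i} |x_{l,n,i} − x̃_{l,n,i}|`. In particular, if each
coordinate differs by at most `2^{−q}` and `q ≥ ⌈log₂(3PLN/δ)⌉` with `δ > 0`, then
`|h_P(x) − h_P(x̃)| ≤ δ`. -/
theorem statement13
    (N L P : ℕ) (hN : 1 ≤ N) (hL : 1 ≤ L) (hP : 1 ≤ P)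
    (U : Fin P → Fin L → Matrix (Fin N → Fin 2) (Fin N → Fin 2) ℂ)
    (hU : ∀ p l, U p l ∈ Matrix.unitaryGroup (Fin N → Fin 2) ℂ)
    (H : Matrix (Fin N → Fin 2) (Fin N → Fin 2) ℂ)
    (hH : H.IsHermitian) (hEig : ∀ i, hH.eigenvalues i ∈ Set.Icc (-1 : ℝ) 1)
    -- the `P`-repeated circuit `V(x) = ∏_{p=P}^{1} ∏_{l=L}^{1} U_{p,l} R_l(x_{[l]})`
    (V : (Fin L → Fin N → Fin 3 → ℝ) → Matrix (Fin N → Fin 2) (Fin N → Fin 2) ℂ)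
    (hV : ∀ x, V x =
      (List.ofFn fun p : Fin P =>
        (List.ofFn fun l : Fin L => U p l * layerGate (x l)).reverse.prod).reverse.prod)
    -- the circuit output `h_P(x) = Tr[H V(x) ρ₀ V(x)†]`
    (h : (Fin L → Fin N → Fin 3 → ℝ) → ℝ)
    (hh : ∀ x, h x = ((H * (V x * rho0 N * (V x)ᴴ)).trace).re)
    (x x' : Fin L → Fin N → Fin 3 → ℝ) :
    |h x - h x'| ≤ (P : ℝ) * ∑ l, ∑ n, ∑ i, |x l n i - x' l n i| ∧
    ∀ (q : ℕ) (δ : ℝ), 0 < δ →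
      (∀ l n i, |x l n i - x' l n i| ≤ (2 : ℝ) ^ (-(q : ℤ))) →
      ⌈Real.logb 2 (3 * (P : ℝ) * L * N / δ)⌉ ≤ (q : ℤ) →
      |h x - h x'| ≤ δ := by
  have hlip : |h x - h x'| ≤ (P : ℝ) * ∑ l, ∑ n, ∑ i, |x l n i - x' l n i| := by
    rw [hh, hh]
    exact abs_circuit_output_sub_le hU hH hEig hV x x'
  refine ⟨hlip, fun q δ hδ hx hq => hlip.trans ?_⟩
  have hsum : ∑ l, ∑ n, ∑ i, |x l n i - x' l n i| ≤
      ∑ _l : Fin L, ∑ _n : Fin N, ∑ _i : Fin 3, (2 : ℝ) ^ (-(q : ℤ)) :=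
    Finset.sum_le_sum fun l _ => Finset.sum_le_sum fun n _ => Finset.sum_le_sum fun i _ => hx l n i
  simp only [Finset.sum_const, Finset.card_univ, Fintype.card_fin, nsmul_eq_mul, _root_.zpow_neg,
    zpow_natCast] at hsum
  have hpos : 0 < 3 * (P : ℝ) * L * N / δ := by positivity
  have hlog : Real.logb 2 (3 * (P : ℝ) * L * N / δ) ≤ (q : ℝ) := by
    exact_mod_cast Int.ceil_le.1 hq
  rw [Real.logb_le_iff_le_rpow one_lt_two hpos, Real.rpow_natCast, div_le_iff₀ hδ] at hlog
  calc (P : ℝ) * ∑ l, ∑ n, ∑ i, |x l n i - x' l n i|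
      ≤ P * (L * (N * (3 * ((2 : ℝ) ^ q)⁻¹))) := by gcongr; exact_mod_cast hsum
    _ = 3 * (P : ℝ) * L * N / 2 ^ q := by ring
    _ ≤ δ := by rw [div_le_iff₀ (by positivity)]; linarith
end
end

section
/- Let ρ₁, ρ₂ ∈ ℂ^{d×d} be density matrices with ρ₂ positive definite. Then the trace distance T(ρ₁, ρ₂) = (1/2)·‖ρ₁ − ρ₂‖₁ satisfies T(ρ₁, ρ₂) ≤ √(1 − 1/Tr[ρ₁² ρ₂⁻¹]) = √(1 − 2^{−D₂(ρ₁‖ρ₂)}), where D₂(ρ₁‖ρ₂) = log₂(Tr[ρ₁² ρ₂⁻¹]) is the Petz–Rényi-2 divergence. In particular, for any 2^N × 2^N Hermitian matrix H with all eigenvalues in [−1,1], |Tr[Hρ₁] − Tr[Hρ₂]| ≤ 2·√(1 − 2^{−D₂(ρ₁‖ρ₂)}). -/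
open Matrix
open scoped ComplexOrder

noncomputable section

namespace Matrix

variable {n : Type*} [Fintype n] [DecidableEq n]

open scoped MatrixOrder Matrix.Norms.L2Operator in
theorem PosSemidef.re_trace_mul_nonneg {P ρ : Matrix n n ℂ} (hP : P.PosSemidef)
    (hρ : ρ.PosSemidef) : 0 ≤ ((P * ρ).trace).re := by
  obtain ⟨B, rfl⟩ := CStarAlgebra.nonneg_iff_eq_star_mul_self.mp hρ.nonneg
  have h := (hP.mul_mul_conjTranspose_same B).trace_nonneg
  rw [star_eq_conjTranspose, ← mul_assoc, trace_mul_comm, ← mul_assoc]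
  exact (Complex.le_def.mp h).1

/-- The variational lower bound for `Tr[ρ² σ⁻¹]`. -/
theorem two_mul_re_trace_mul_le {A ρ σ : Matrix n n ℂ} (hA : A.IsHermitian)
    (hρ : ρ.IsHermitian) (hσ : σ.PosDef) :
    2 * ((A * ρ).trace).re ≤ ((A * A * σ).trace).re + ((ρ * ρ * σ⁻¹).trace).re := by
  have hdet : IsUnit σ.det := (Matrix.isUnit_iff_isUnit_det σ).mp hσ.isUnit
  have h := (hσ.posSemidef.conjTranspose_mul_mul_same (A - σ⁻¹ * ρ)).trace_nonneg
  have hexp : (A - σ⁻¹ * ρ)ᴴ * σ * (A - σ⁻¹ * ρ)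
      = A * σ * A - A * ρ - ρ * A + ρ * σ⁻¹ * ρ := by
    rw [conjTranspose_sub, conjTranspose_mul, hA.eq, hρ.eq, conjTranspose_nonsing_inv,
      hσ.isHermitian.eq, sub_mul, mul_sub, sub_mul, sub_mul,
      nonsing_inv_mul_cancel_right _ _ hdet, mul_assoc A σ (σ⁻¹ * ρ),
      mul_nonsing_inv_cancel_left _ _ hdet, mul_assoc ρ σ⁻¹ ρ]
    abel
  rw [hexp, trace_add, trace_sub, trace_sub, trace_mul_comm ρ A, trace_mul_cycle A σ A,
    trace_mul_cycle ρ σ⁻¹ ρ] at h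
  have hre := (Complex.le_def.mp h).1
  simp only [Complex.add_re, Complex.sub_re, Complex.zero_re] at hre
  linarith

theorem abs_re_trace_mul_le_one {H ρ : Matrix n n ℂ} (hH : H.IsHermitian)
    (hHH : (1 - H * H).PosSemidef) (hρ : ρ.PosSemidef) (htr : ρ.trace = 1) :
    |((H * ρ).trace).re| ≤ 1 := by
  have hsq := hHH.re_trace_mul_nonneg hρ
  have key (s : ℂ) (hs : star s = s) :
      0 ≤ (((s • 1 + H) * (s • 1 + H) * ρ).trace).re := by
    refine PosSemidef.re_trace_mul_nonneg ?_ hρ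
    have := posSemidef_conjTranspose_mul_self (s • 1 + H)
    rwa [conjTranspose_add, conjTranspose_smul, conjTranspose_one, hH.eq, hs] at this
  have hp := key 1 (by simp)
  have hm := key (-1) (by simp)
  simp only [add_mul, mul_add, sub_mul, smul_mul_assoc, mul_smul_comm, one_mul, mul_one,
    trace_add, trace_sub, trace_smul, htr, smul_eq_mul, Complex.add_re, Complex.sub_re,
    Complex.one_re, neg_mul, mul_neg, Complex.neg_re, neg_neg] at hsq hp hm
  exact abs_le.mpr ⟨by linarith, by linarith⟩

theorem affine_le_re_trace_sq_mul_inv {H ρ σ : Matrix n n ℂ} (hH : H.IsHermitian)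
    (hHH : (1 - H * H).PosSemidef) (hρ : ρ.IsHermitian) (htρ : ρ.trace = 1)
    (hσ : σ.PosDef) (htσ : σ.trace = 1) (b : ℝ) :
    1 + 2 * b * (((H * ρ).trace).re - ((H * σ).trace).re)
      - b ^ 2 * (1 - ((H * σ).trace).re ^ 2) ≤ ((ρ * ρ * σ⁻¹).trace).re := by
  have hsq := hHH.re_trace_mul_nonneg hσ.posSemidef
  have key (a : ℝ) := two_mul_re_trace_mul_le (A := (a : ℂ) • 1 + (b : ℂ) • H)
    (by simp [IsHermitian, hH.eq]) hρ hσ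
  have h := key (1 - b * ((H * σ).trace).re)
  simp only [add_mul, mul_add, sub_mul, smul_mul_assoc, mul_smul_comm, one_mul, mul_one,
    trace_add, trace_sub, trace_smul, htρ, htσ, smul_eq_mul, Complex.add_re, Complex.sub_re,
    Complex.one_re, Complex.re_ofReal_mul, Complex.ofReal_re] at hsq h
  nlinarith [mul_nonneg (sq_nonneg b) hsq]

end Matrix

theorem half_abs_sub_le_sqrt_of_affine_le {x y Q : ℝ} (hx : |x| ≤ 1) (hy : |y| ≤ 1)
    (hQ : ∀ b : ℝ, 1 + 2 * b * (x - y) - b ^ 2 * (1 - y ^ 2) ≤ Q) :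
    1 / 2 * |x - y| ≤ √(1 - 1 / Q) := by
  rw [abs_le] at hx hy
  have hQ1 : 1 ≤ Q := by simpa using hQ 0
  have hle : 1 - y ^ 2 ≤ 4 - (x - y) ^ 2 := by nlinarith
  have hpos : 0 < 4 - (x - y) ^ 2 := by
    by_contra! h
    have := hQ ((x - y) * Q)
    have h4 : (4 : ℝ) ≤ (x - y) ^ 2 := by linarith
    have : ((x - y) * Q) ^ 2 * (1 - y ^ 2) ≤ 0 :=
      mul_nonpos_of_nonneg_of_nonpos (sq_nonneg _) (by linarith)
    nlinarith
  have hmain : 4 ≤ Q * (4 - (x - y) ^ 2) := by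
    set s := 4 - (x - y) ^ 2 with hs
    have h := hQ ((x - y) / s)
    have hb : ((x - y) / s) ^ 2 * (1 - y ^ 2) ≤ ((x - y) / s) ^ 2 * s :=
      mul_le_mul_of_nonneg_left hle (sq_nonneg _)
    have e : 1 + 2 * ((x - y) / s) * (x - y) - ((x - y) / s) ^ 2 * s = 4 / s := by
      field_simp
      rw [hs]; ring
    rw [← div_le_iff₀ hpos]
    linarith
  apply Real.le_sqrt_of_sq_le
  rw [mul_pow, sq_abs, le_sub_comm, div_le_iff₀ (by linarith)]
  linarith

namespace Matrix

variable {n : Type*} [Fintype n] [DecidableEq n]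

theorem half_abs_re_trace_mul_sub_le {H ρ σ : Matrix n n ℂ} (hH : H.IsHermitian)
    (hHH : (1 - H * H).PosSemidef) (hρ : ρ.PosSemidef) (htρ : ρ.trace = 1)
    (hσ : σ.PosDef) (htσ : σ.trace = 1) :
    1 / 2 * |((H * ρ).trace).re - ((H * σ).trace).re|
      ≤ √(1 - 1 / ((ρ * ρ * σ⁻¹).trace).re) :=
  half_abs_sub_le_sqrt_of_affine_le (abs_re_trace_mul_le_one hH hHH hρ htρ)
    (abs_re_trace_mul_le_one hH hHH hσ.posSemidef htσ)
    (affine_le_re_trace_sq_mul_inv hH hHH hρ.isHermitian htρ hσ htσ)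

theorem posSemidef_one_sub_mul_self_of_eq_conj {U : unitaryGroup n ℂ} {f : n → ℝ}
    (hf : ∀ i, f i ^ 2 ≤ 1) {H : Matrix n n ℂ}
    (hH : H = Unitary.conjStarAlgAut ℂ _ U (diagonal fun i => (f i : ℂ))) :
    (1 - H * H).PosSemidef := by
  rw [hH, ← map_mul, ← map_one (Unitary.conjStarAlgAut ℂ (Matrix n n ℂ) U), ← map_sub,
    Unitary.conjStarAlgAut_apply]
  refine PosSemidef.mul_mul_conjTranspose_same ?_ _
  rw [diagonal_mul_diagonal, ← diagonal_one, diagonal_sub, posSemidef_diagonal_iff]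
  intro i
  have := hf i
  rw [← Complex.ofReal_mul, ← Complex.ofReal_one, ← Complex.ofReal_sub, Complex.zero_le_real]
  nlinarith

theorem IsHermitian.posSemidef_one_sub_mul_self {H : Matrix n n ℂ} (hH : H.IsHermitian)
    (h : ∀ i, hH.eigenvalues i ∈ Set.Icc (-1 : ℝ) 1) : (1 - H * H).PosSemidef :=
  posSemidef_one_sub_mul_self_of_eq_conj (f := hH.eigenvalues)
    (fun i => by nlinarith [(h i).1, (h i).2]) hH.spectral_theorem

/-- The sign of a Hermitian matrix attains its trace norm. -/
theorem IsHermitian.exists_re_trace_mul_eq_sum_abs_eigenvalues {M : Matrix n n ℂ}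
    (hM : M.IsHermitian) : ∃ H : Matrix n n ℂ, H.IsHermitian ∧ (1 - H * H).PosSemidef ∧
      ((H * M).trace).re = ∑ i, |hM.eigenvalues i| := by
  let φ := Unitary.conjStarAlgAut ℂ (Matrix n n ℂ) hM.eigenvectorUnitary
  let f : n → ℝ := fun i => SignType.sign (hM.eigenvalues i)
  refine ⟨φ (diagonal fun i => (f i : ℂ)), ?_,
    posSemidef_one_sub_mul_self_of_eq_conj (fun i => ?_) rfl, ?_⟩
  · rw [IsHermitian, ← star_eq_conjTranspose, ← map_star, star_eq_conjTranspose,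
      diagonal_conjTranspose]
    congr 2
    ext i
    simp
  · simp only [f]
    cases SignType.sign (hM.eigenvalues i) <;> simp
  · conv_lhs => rw [hM.spectral_theorem]
    change ((φ _ * φ _).trace).re = _
    rw [← map_mul, Unitary.conjStarAlgAut_apply, trace_mul_comm, ← mul_assoc,
      Unitary.coe_star_mul_self, one_mul, diagonal_mul_diagonal, trace_diagonal, Complex.re_sum]
    refine Finset.sum_congr rfl fun i _ => ?_
    simp [f, ← sign_mul_self]

end Matrix

/-- For density matrices `ρ₁, ρ₂` with `ρ₂` positive definite, the
trace distance `T(ρ₁,ρ₂) = (1/2)·Σᵢ|λᵢ(ρ₁ − ρ₂)|` is bounded by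
`√(1 − 1/Tr[ρ₁²ρ₂⁻¹]) = √(1 − 2^{−D₂(ρ₁‖ρ₂)})`, and consequently for any Hermitian `H`
with eigenvalues in `[−1,1]`, `|Tr[Hρ₁] − Tr[Hρ₂]| ≤ 2·√(1 − 2^{−D₂(ρ₁‖ρ₂)})`. -/
theorem statement15
    (d : ℕ) (ρ₁ ρ₂ : Matrix (Fin d) (Fin d) ℂ)
    (h1 : ρ₁.PosSemidef) (htr1 : ρ₁.trace = 1)
    (h2 : ρ₂.PosDef) (htr2 : ρ₂.trace = 1)
    -- the Petz–Rényi-2 divergence `D₂(ρ₁‖ρ₂) = log₂(Tr[ρ₁² ρ₂⁻¹])`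
    (D2 : ℝ) (hD2 : D2 = Real.logb 2 (((ρ₁ * ρ₁ * ρ₂⁻¹).trace).re)) :
    (1 / 2) * ∑ i, |(h1.isHermitian.sub h2.posSemidef.isHermitian).eigenvalues i|
        ≤ Real.sqrt (1 - 1 / ((ρ₁ * ρ₁ * ρ₂⁻¹).trace).re) ∧
    Real.sqrt (1 - 1 / ((ρ₁ * ρ₁ * ρ₂⁻¹).trace).re)
        = Real.sqrt (1 - (2 : ℝ) ^ (-D2)) ∧
    ∀ (H : Matrix (Fin d) (Fin d) ℂ) (hH : H.IsHermitian),
      (∀ i, hH.eigenvalues i ∈ Set.Icc (-1 : ℝ) 1) →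
      |((H * ρ₁).trace).re - ((H * ρ₂).trace).re|
        ≤ 2 * Real.sqrt (1 - (2 : ℝ) ^ (-D2)) := by
  have bound {H : Matrix (Fin d) (Fin d) ℂ} (hH : H.IsHermitian)
      (hHH : (1 - H * H).PosSemidef) :=
    half_abs_re_trace_mul_sub_le hH hHH h1 htr1 h2 htr2
  have hQ : 1 ≤ ((ρ₁ * ρ₁ * ρ₂⁻¹).trace).re := by
    have h := two_mul_re_trace_mul_le (isHermitian_one (n := Fin d) (α := ℂ))
      h1.isHermitian h2
    rw [one_mul, one_mul, one_mul, htr1, htr2, Complex.one_re] at h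
    linarith
  have hD : (2 : ℝ) ^ (-D2) = 1 / ((ρ₁ * ρ₁ * ρ₂⁻¹).trace).re := by
    rw [hD2, Real.rpow_neg two_pos.le,
      Real.rpow_logb two_pos (by norm_num) (one_pos.trans_le hQ), one_div]
  refine ⟨?_, by rw [hD], fun H hH hev => ?_⟩
  · obtain ⟨H, hH, hHH, htr⟩ := (h1.isHermitian.sub
      h2.posSemidef.isHermitian).exists_re_trace_mul_eq_sum_abs_eigenvalues
    rw [← htr, mul_sub, trace_sub, Complex.sub_re]
    exact (mul_le_mul_of_nonneg_left (le_abs_self _) (by norm_num)).trans (bound hH hHH)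
  · rw [hD]
    linarith [bound hH (hH.posSemidef_one_sub_mul_self hev)]
end
end

section
/- Let 𝒳 be a measurable space with probability measure 𝒟 and let ρ: 𝒳 → ℂ^{2^N × 2^N} be a measurable family of pure-state density matrices. Let x^{(1)}, …, x^{(M)} be i.i.d. samples from 𝒟, and define f(x^{(1)},…,x^{(M)}) = Tr[ρ̄_M²] where ρ̄_M = (1/M)·Σ_{m=1}^M ρ(x^{(m)}). Then: (1) f satisfies the bounded-differences property with constant 2/M, i.e., replacing any single sample x^{(n)} by another point changes the value of f by at most 2/M; and (2) consequently, for every t > 0, with probability at least 1 − 2·exp(−M·t²/2) over the samples: |Tr[ρ̄_M²] − E[Tr[ρ̄_M²]]| ≤ t. -/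
open Matrix MeasureTheory
open scoped ComplexOrder ENNReal

noncomputable section

open ProbabilityTheory
open scoped NNReal

section BoundedDifferences

variable {𝒳 : Type*}

/-- A function with bounded differences varies by at most the sum of the bounds. -/
theorem abs_sub_le_sum_of_abs_sub_update_le {ι : Type*} [Fintype ι] [DecidableEq ι]
    {f : (ι → 𝒳) → ℝ} {c : ι → ℝ≥0}
    (h : ∀ x i x', |f x - f (Function.update x i x')| ≤ c i) (x y : ι → 𝒳) :
    |f x - f y| ≤ ∑ i, (c i : ℝ) := by
  have key (s : Finset ι) : |f x - f (s.piecewise y x)| ≤ ∑ i ∈ s, (c i : ℝ) := by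
    induction s using Finset.induction_on with
    | empty => simp
    | insert j s hj ih =>
      rw [Finset.piecewise_insert, Finset.sum_insert hj, add_comm]
      exact (abs_sub_le _ (f (s.piecewise y x)) _).trans (add_le_add ih (h _ _ _))
  simpa using key Finset.univ

/-- **Hoeffding's lemma** for a function whose oscillation is at most `c`. -/
theorem hasSubgaussianMGF_of_abs_sub_le [MeasurableSpace 𝒳] {μ : Measure 𝒳}
    [IsProbabilityMeasure μ] {f : 𝒳 → ℝ} (hf : Measurable f) {c : ℝ≥0}
    (h : ∀ x y, |f x - f y| ≤ c) :
    HasSubgaussianMGF (fun x => f x - ∫ y, f y ∂μ) ((c / 2) ^ 2) μ := by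
  obtain ⟨x₀⟩ : Nonempty 𝒳 := nonempty_of_isProbabilityMeasure μ
  have hbdd : BddBelow (Set.range f) := by
    refine ⟨f x₀ - c, ?_⟩
    rintro _ ⟨x, rfl⟩
    linarith [(abs_le.1 (h x₀ x)).2]
  have hmem : ∀ x, f x ∈ Set.Icc (⨅ y, f y) ((⨅ y, f y) + c) := fun x => by
    refine ⟨ciInf_le hbdd x, ?_⟩
    have : f x - c ≤ ⨅ y, f y := by
      have : Nonempty 𝒳 := ⟨x₀⟩
      exact le_ciInf fun y => by linarith [(abs_le.1 (h x y)).2]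
    linarith
  simpa using hasSubgaussianMGF_of_mem_Icc hf.aemeasurable (Filter.Eventually.of_forall hmem)

/-- The moment-generating function form of **McDiarmid's inequality**: a measurable function of
independent variables with bounded differences `c i` is, once centred, sub-Gaussian with parameter
`∑ i, (c i / 2) ^ 2`. -/
theorem hasSubgaussianMGF_of_abs_sub_update_le [MeasurableSpace 𝒳] {n : ℕ}
    (μ : Fin n → Measure 𝒳) [∀ i, IsProbabilityMeasure (μ i)] {f : (Fin n → 𝒳) → ℝ}
    (hf : Measurable f) {c : Fin n → ℝ≥0}
    (h : ∀ x i x', |f x - f (Function.update x i x')| ≤ c i) :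
    HasSubgaussianMGF (fun x => f x - ∫ y, f y ∂Measure.pi μ) (∑ i, (c i / 2) ^ 2)
      (Measure.pi μ) := by
  induction n with
  | zero =>
    have hconst (x : Fin 0 → 𝒳) : f x - ∫ y, f y ∂Measure.pi μ = 0 := by
      have (y : Fin 0 → 𝒳) : f y = f x := congrArg f (Subsingleton.elim y x)
      simp [this]
    simp [hconst]
  | succ n ih =>
    set ν : Measure (Fin n → 𝒳) := Measure.pi fun i => μ i.succ with hν
    let e : 𝒳 × (Fin n → 𝒳) → Fin (n + 1) → 𝒳 := fun p => Fin.cons p.1 p.2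
    have he_eq : ⇑(MeasurableEquiv.piFinSuccAbove (fun _ => 𝒳) 0).symm = e :=
      funext fun p => Fin.insertNth_zero' p.1 p.2
    have he : MeasurePreserving e ((μ 0).prod ν) (Measure.pi μ) := by
      simpa [he_eq] using! (measurePreserving_piFinSuccAbove μ 0).symm
    have hemb : MeasurableEmbedding e :=
      he_eq ▸ (MeasurableEquiv.piFinSuccAbove (fun _ => 𝒳) 0).symm.measurableEmbedding
    have hF : Measurable (f ∘ e) := hf.comp he.measurable
    have hosc := abs_sub_le_sum_of_abs_sub_update_le h
    obtain ⟨x₀⟩ : Nonempty (Fin (n + 1) → 𝒳) :=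
      nonempty_of_isProbabilityMeasure (Measure.pi μ)
    have hmem (x) : f x ∈ Set.Icc (f x₀ - ∑ i, (c i : ℝ)) (f x₀ + ∑ i, (c i : ℝ)) :=
      ⟨by linarith [(abs_le.1 (hosc x₀ x)).2], by linarith [(abs_le.1 (hosc x₀ x)).1]⟩
    have hint_prod : Integrable (f ∘ e) ((μ 0).prod ν) :=
      .of_mem_Icc _ _ hF.aemeasurable (.of_forall fun p => hmem _)
    have hslice (y) : Measurable fun x => f (e (x, y)) := hF.comp measurable_prodMk_right
    have hint (y) : Integrable (fun x => f (e (x, y))) (μ 0) :=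
      .of_mem_Icc _ _ (hslice y).aemeasurable (.of_forall fun x => hmem _)
    set g : (Fin n → 𝒳) → ℝ := fun y => ∫ x, f (e (x, y)) ∂μ 0 with hg
    have hgm : Measurable g :=
      (hF.stronglyMeasurable.integral_prod_left').measurable
    have hgd : ∀ y i y', |g y - g (Function.update y i y')| ≤ c i.succ := fun y i y' => by
      rw [hg, ← integral_sub (hint _) (hint _)]
      have hle (x) : ‖f (e (x, y)) - f (e (x, Function.update y i y'))‖ ≤ c i.succ := by
        simpa only [e, Fin.cons_update] using! h (Fin.cons x y) i.succ y'
      simpa using norm_integral_le_of_norm_le_const (μ := μ 0) (.of_forall hle)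
    have hmean : ∫ y, f y ∂Measure.pi μ = ∫ y, g y ∂ν := by
      rw [← he.integral_comp hemb]
      exact integral_prod_symm _ hint_prod
    have hinner (y) := hasSubgaussianMGF_of_abs_sub_le (μ := μ 0) (c := c 0) (hslice y)
      fun x x' => by simpa only [e, Fin.update_cons_zero] using! h (Fin.cons x y) 0 x'
    have houter := ih (fun i => μ i.succ) hgm hgd
    rw [← hν, ← hmean] at houter
    set E := ∫ y, f y ∂Measure.pi μ
    have hexp (t : ℝ) : Integrable (fun x => Real.exp (t * (f x - E))) (Measure.pi μ) :=
      integrable_exp_mul_of_mem_Icc (hf.sub_const E).aemeasurable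
        (.of_forall fun x => ⟨sub_le_sub_right (hmem x).1 E, sub_le_sub_right (hmem x).2 E⟩)
    refine ⟨hexp, fun t => ?_⟩
    have hexp_prod : Integrable (fun p => Real.exp (t * (f (e p) - E))) ((μ 0).prod ν) :=
      (he.integrable_comp_emb hemb).2 (hexp t)
    calc
      mgf (fun x => f x - E) (Measure.pi μ) t
          = ∫ y, ∫ x, Real.exp (t * (f (e (x, y)) - E)) ∂μ 0 ∂ν := by
        rw [mgf, ← he.integral_comp hemb]
        exact integral_prod_symm _ hexp_prod
      _ ≤ ∫ y, Real.exp (((c 0 / 2) ^ 2 : ℝ≥0) * t ^ 2 / 2) * Real.exp (t * (g y - E)) ∂ν := by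
        refine integral_mono hexp_prod.integral_prod_right
          ((houter.integrable_exp_mul t).const_mul _) fun y => ?_
        have hsplit (x) : Real.exp (t * (f (e (x, y)) - E))
            = Real.exp (t * (f (e (x, y)) - g y)) * Real.exp (t * (g y - E)) := by
          rw [← Real.exp_add]
          ring_nf
        simp only [hsplit, integral_mul_const]
        exact mul_le_mul_of_nonneg_right ((hinner y).mgf_le t) (Real.exp_pos _).le
      _ ≤ Real.exp (((c 0 / 2) ^ 2 : ℝ≥0) * t ^ 2 / 2)
            * Real.exp ((∑ i : Fin n, (c i.succ / 2) ^ 2 : ℝ≥0) * t ^ 2 / 2) := by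
        rw [integral_const_mul]
        exact mul_le_mul_of_nonneg_left (houter.mgf_le t) (Real.exp_pos _).le
      _ = Real.exp ((∑ i, (c i / 2) ^ 2 : ℝ≥0) * t ^ 2 / 2) := by
        rw [← Real.exp_add, Fin.sum_univ_succ, NNReal.coe_add]
        ring_nf

/-- Two-sided Chernoff bound for a sub-Gaussian random variable. -/
theorem one_sub_le_measureReal_abs_le {Ω : Type*} [MeasurableSpace Ω] {μ : Measure Ω}
    [IsProbabilityMeasure μ] {X : Ω → ℝ} {c : ℝ≥0} (h : HasSubgaussianMGF X c μ) {t : ℝ}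
    (ht : 0 ≤ t) : 1 - 2 * Real.exp (-t ^ 2 / (2 * c)) ≤ μ.real {ω | |X ω| ≤ t} := by
  have hcover : (Set.univ : Set Ω) ⊆
      {ω | |X ω| ≤ t} ∪ ({ω | t ≤ X ω} ∪ {ω | t ≤ (-X) ω}) := fun ω _ => by
    by_cases hω : |X ω| ≤ t
    · exact .inl hω
    · exact .inr (le_abs.1 (not_le.1 hω).le)
  have h1 : μ.real Set.univ ≤ _ := measureReal_mono hcover
  rw [probReal_univ] at h1
  have h2 := measureReal_union_le (μ := μ) {ω | |X ω| ≤ t} ({ω | t ≤ X ω} ∪ {ω | t ≤ (-X) ω})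
  have h3 := measureReal_union_le (μ := μ) {ω | t ≤ X ω} {ω | t ≤ (-X) ω}
  linarith [h.measure_ge_le ht, h.neg.measure_ge_le ht]

end BoundedDifferences

section Purity

variable {ι : Type*} [Fintype ι]

theorem re_trace_mul_nonneg {P Q : Matrix ι ι ℂ} (hP : P.IsHermitian) (hPP : P * P = P)
    (hQ : Q.PosSemidef) : 0 ≤ (P * Q).trace.re := by
  have h := (hQ.conjTranspose_mul_mul_same P).trace_nonneg
  rw [hP.eq, Matrix.trace_mul_comm, ← Matrix.mul_assoc, hPP] at h
  exact (Complex.le_def.1 h).1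

theorem re_trace_mul_le_re_trace {P Q : Matrix ι ι ℂ} (hP : P.IsHermitian) (hPP : P * P = P)
    (hQ : Q.PosSemidef) : (P * Q).trace.re ≤ Q.trace.re := by
  classical
  have h := re_trace_mul_nonneg (P := 1 - P) (Matrix.isHermitian_one.sub hP)
    (by simp [sub_mul, mul_sub, hPP]) hQ
  rw [Matrix.sub_mul, Matrix.one_mul, Matrix.trace_sub, Complex.sub_re] at h
  linarith

end Purity

/-- For i.i.d. samples from `𝒟` and a measurable family of pure-state
density matrices, the purity `f(x⁽¹⁾,…,x⁽ᴹ⁾) = Tr[ρ̄_M²]` of the average state satisfies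
the bounded-differences property with constant `2/M`, and consequently (McDiarmid)
`|Tr[ρ̄_M²] − E[Tr[ρ̄_M²]]| ≤ t` with probability at least `1 − 2·exp(−Mt²/2)`. -/
theorem statement18
    {𝒳 : Type*} [MeasurableSpace 𝒳] (D : Measure 𝒳) [IsProbabilityMeasure D]
    (N M : ℕ)
    (ρ : 𝒳 → Matrix (Fin N → Fin 2) (Fin N → Fin 2) ℂ)
    (hmeas : ∀ i j, Measurable fun x => ρ x i j)
    -- pure-state density matrices: `ρ(x)² = ρ(x)`, `Tr[ρ(x)] = 1`
    (hρ : ∀ x, (ρ x).PosSemidef ∧ (ρ x).trace = 1 ∧ ρ x * ρ x = ρ x)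
    -- the purity of the average state of the samples
    (f : (Fin M → 𝒳) → ℝ)
    (hf : ∀ X, f X =
      ((((M : ℂ)⁻¹ • ∑ m, ρ (X m)) * ((M : ℂ)⁻¹ • ∑ m, ρ (X m))).trace).re) :
    (∀ (X : Fin M → 𝒳) (n : Fin M) (x' : 𝒳),
      |f X - f (Function.update X n x')| ≤ 2 / (M : ℝ)) ∧
    ∀ t : ℝ, 0 < t →
      ENNReal.ofReal (1 - 2 * Real.exp (-(M : ℝ) * t ^ 2 / 2)) ≤
        (Measure.pi fun _ : Fin M => D)
          {X | |f X - ∫ X', f X' ∂(Measure.pi fun _ : Fin M => D)| ≤ t} := by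
  have hMre : ∀ A : Matrix (Fin N → Fin 2) (Fin N → Fin 2) ℂ,
      (((M : ℂ)⁻¹ • A).trace).re = (M : ℝ)⁻¹ * A.trace.re := fun A => by
    rw [Matrix.trace_smul, smul_eq_mul, ← Complex.ofReal_natCast, ← Complex.ofReal_inv,
      Complex.re_ofReal_mul]
  have hoverlap (x : 𝒳) (X : Fin M → 𝒳) :
      (ρ x * ((M : ℂ)⁻¹ • ∑ m, ρ (X m))).trace.re ∈ Set.Icc (0 : ℝ) 1 := by
    obtain ⟨hpos, -, hidem⟩ := hρ x
    have hle (m : Fin M) : (ρ x * ρ (X m)).trace.re ≤ 1 := by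
      simpa [(hρ (X m)).2.1] using
        re_trace_mul_le_re_trace hpos.isHermitian hidem (hρ (X m)).1
    rw [Matrix.mul_smul, hMre, Matrix.mul_sum, Matrix.trace_sum, Complex.re_sum]
    refine ⟨mul_nonneg (by positivity) (Finset.sum_nonneg fun m _ =>
      re_trace_mul_nonneg hpos.isHermitian hidem (hρ (X m)).1), ?_⟩
    calc (M : ℝ)⁻¹ * ∑ m, (ρ x * ρ (X m)).trace.re
        ≤ (M : ℝ)⁻¹ * ∑ _m : Fin M, 1 := by gcongr with m; exact hle m
      _ ≤ 1 := by simpa using inv_mul_le_one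
  have hbd (X : Fin M → 𝒳) (n : Fin M) (x' : 𝒳) :
      |f X - f (Function.update X n x')| ≤ 2 / (M : ℝ) := by
    set Y := Function.update X n x' with hY
    set A := (M : ℂ)⁻¹ • ∑ m, ρ (X m) with hA
    set B := (M : ℂ)⁻¹ • ∑ m, ρ (Y m) with hB
    have hdiff : A - B = (M : ℂ)⁻¹ • (ρ (X n) - ρ x') := by
      rw [hA, hB, ← smul_sub, ← Finset.sum_sub_distrib,
        Finset.sum_eq_single n (fun m _ hm => by simp [hY, hm]) (by simp)]
      simp [hY]
    have htrace : (A * A).trace - (B * B).trace = ((A - B) * (A + B)).trace := by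
      rw [Matrix.sub_mul, Matrix.mul_add, Matrix.mul_add, Matrix.trace_sub, Matrix.trace_add,
        Matrix.trace_add, Matrix.trace_mul_comm B A]
      ring
    have hfd : f X - f Y = (M : ℝ)⁻¹ * (((ρ (X n) * A).trace.re + (ρ (X n) * B).trace.re)
        - ((ρ x' * A).trace.re + (ρ x' * B).trace.re)) := by
      rw [hf, hf, ← hA, ← hB, ← Complex.sub_re, htrace, hdiff, Matrix.smul_mul, hMre]
      simp only [Matrix.sub_mul, Matrix.mul_add, Matrix.trace_sub, Matrix.trace_add,
        Complex.sub_re, Complex.add_re]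
      ring
    obtain ⟨h1, h1'⟩ := hoverlap (X n) X
    obtain ⟨h2, h2'⟩ := hoverlap (X n) Y
    obtain ⟨h3, h3'⟩ := hoverlap x' X
    obtain ⟨h4, h4'⟩ := hoverlap x' Y
    rw [hfd, abs_mul, abs_of_nonneg (by positivity : (0 : ℝ) ≤ (M : ℝ)⁻¹), div_eq_inv_mul]
    refine mul_le_mul_of_nonneg_left (abs_le.2 ⟨?_, ?_⟩) (by positivity) <;> linarith
  refine ⟨hbd, fun t ht => ?_⟩
  have hfm : Measurable f := by
    rw [funext hf]
    simp only [Matrix.trace, Matrix.diag_apply, Matrix.mul_apply, Matrix.smul_apply,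
      Matrix.sum_apply, smul_eq_mul]
    have := fun i j (m : Fin M) => (hmeas i j).comp (measurable_pi_apply (X := fun _ => 𝒳) m)
    simp only [Function.comp_def] at this
    fun_prop
  have hsub := hasSubgaussianMGF_of_abs_sub_update_le (fun _ => D) hfm
    (c := fun _ => 2 / (M : ℝ≥0)) (by simpa using hbd)
  refine ENNReal.ofReal_le_of_le_toReal (le_of_eq_of_le ?_
    (one_sub_le_measureReal_abs_le hsub ht.le))
  congr 3
  rcases eq_or_ne M 0 with rfl | hM
  · simp
  · have : (M : ℝ) ≠ 0 := Nat.cast_ne_zero.2 hM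
    simp
    field_simp
end
end
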